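/- arXiv:1307.5411 — 2 statements merged into one kernel-verified Lean document; each statement's English description precedes it below -/
import Mathlib

section
/- Let n be a positive integer and let G be a graph cospectral with the friendship graph F_n. Then G contains no induced cycle C_m with m odd and m ≥ 5, and G contains no induced subgraph isomorphic to the complement of a cycle C_m with m odd and m ≥ 5 (so G and its complement are Berge, hence perfect). -/
open Polynomial

/-- The adjacency matrix of a simple graph, with entries in `R`. -/
noncomputable def adjMat (R : Type*) [Zero R] [One R] {V : Type*} [Fintype V]
    (G : SimpleGraph V) : Matrix V V R :=
  letI := Classical.decRel G.Adj
  G.adjMatrix R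

/-- The friendship graph `F n`: `n` triangles glued at the common vertex `none`. -/
def friendshipGraph (n : ℕ) : SimpleGraph (Option (Fin n × Bool)) :=
  SimpleGraph.fromRel (fun u v =>
    u = none ∨ ∃ i : Fin n, u = some (i, true) ∧ v = some (i, false))

/-- Two finite graphs are cospectral if their real adjacency matrices have the same
characteristic polynomial. -/
def Cospectral {V W : Type*} [Fintype V] [Fintype W] [DecidableEq V] [DecidableEq W]
    (G : SimpleGraph V) (H : SimpleGraph W) : Prop :=
  (adjMat ℝ G).charpoly = (adjMat ℝ H).charpoly

open Matrix in
/-- The shifted quadratic form `xᵀ A x - c xᵀ x` of the matrix `A`. -/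
def shiftedForm {V : Type*} [Fintype V] (c : ℝ) (A : Matrix V V ℝ) (x : V → ℝ) : ℝ :=
  x ⬝ᵥ A *ᵥ x - c * (x ⬝ᵥ x)

/-- There is a plane on which the shifted quadratic form of `A` is negative definite. -/
def HasNegPlane {V : Type*} [Fintype V] (c : ℝ) (A : Matrix V V ℝ) : Prop :=
  ∃ x y : V → ℝ, ∀ a b : ℝ, (a ≠ 0 ∨ b ≠ 0) → shiftedForm c A (a • x + b • y) < 0

lemma shiftedForm_eq_sum {V : Type*} [Fintype V] (c : ℝ) (A : Matrix V V ℝ) (x : V → ℝ) :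
    shiftedForm c A x = ∑ i, ((∑ j, x i * (A i j * x j)) - c * (x i * x i)) := by
  simp [shiftedForm, dotProduct, Matrix.mulVec, Finset.mul_sum, Finset.sum_sub_distrib]

/-- A form which is nonnegative on a hyperplane has no negative definite plane. -/
lemma not_hasNegPlane_of_nonneg_on_ker {V : Type*} [Fintype V] {c : ℝ} {A : Matrix V V ℝ}
    (φ : (V → ℝ) →ₗ[ℝ] ℝ) (h : ∀ x, φ x = 0 → 0 ≤ shiftedForm c A x) :
    ¬ HasNegPlane c A := by
  rintro ⟨x, y, hxy⟩
  by_cases hx : φ x = 0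
  · have h0 := h x hx
    have h1 := hxy 1 0 (by simp)
    simp only [one_smul, zero_smul, add_zero] at h1
    linarith
  · have h0 := h (φ y • x + (-φ x) • y) (by simp; ring)
    have h1 := hxy (φ y) (-φ x) (by simp [hx])
    linarith

/-- Negative definite planes of a principal submatrix extend by zero. -/
lemma HasNegPlane.of_submatrix {V W : Type*} [Fintype V] [Fintype W] {c : ℝ}
    {A : Matrix V V ℝ} {f : W → V} (hf : Function.Injective f)
    (h : HasNegPlane c (A.submatrix f f)) : HasNegPlane c A := by
  obtain ⟨x, y, hxy⟩ := h
  refine ⟨Function.extend f x 0, Function.extend f y 0, fun a b hab => ?_⟩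
  convert hxy a b hab using 1
  have hin : ∀ w, (a • Function.extend f x 0 + b • Function.extend f y 0) (f w) =
      (a • x + b • y) w := fun w => by simp [hf.extend_apply]
  have hout : ∀ v, v ∉ Set.range f →
      (a • Function.extend f x 0 + b • Function.extend f y 0) v = 0 := fun v hv => by
    simp [Function.extend_apply' _ _ _ (show ¬ ∃ w, f w = v from hv)]
  simp only [shiftedForm_eq_sum]
  refine (Fintype.sum_of_injective f hf _ _ (fun v hv => ?_) (fun w => ?_)).symm
  · simp [hout v hv]
  · rw [hin]
    congr 1
    refine Fintype.sum_of_injective f hf _ _ (fun v hv => ?_) (fun u => ?_)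
    · simp [hout v hv]
    · simp [hin]

section Spectral

open Matrix

variable {V : Type*} [Fintype V] [DecidableEq V] {A : Matrix V V ℝ}

lemma shiftedForm_eigenvectorUnitary_mulVec (hA : A.IsHermitian) (c : ℝ) (z : V → ℝ) :
    shiftedForm c A ((hA.eigenvectorUnitary : Matrix V V ℝ) *ᵥ z) =
      ∑ i, (hA.eigenvalues i - c) * z i ^ 2 := by
  set U : Matrix V V ℝ := (hA.eigenvectorUnitary : Matrix V V ℝ) with hU
  have hUU : Uᵀ * U = 1 := by
    have := Unitary.coe_star_mul_self hA.eigenvectorUnitary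
    simpa [star_eq_conjTranspose] using this
  have hspec : A * U = U * diagonal hA.eigenvalues := by
    ext i j
    have := congrFun (hA.mulVec_eigenvectorBasis j) i
    rw [mul_diagonal]
    simpa [hU, Matrix.mul_apply, mulVec, dotProduct, mul_comm] using this
  have hdot : ∀ y w : V → ℝ, (U *ᵥ y) ⬝ᵥ (U *ᵥ w) = y ⬝ᵥ w := fun y w => by
    rw [dotProduct_mulVec, ← mulVec_transpose, mulVec_mulVec, hUU, one_mulVec]
  rw [shiftedForm, mulVec_mulVec, hspec, ← mulVec_mulVec, hdot, hdot]
  simp only [dotProduct, mulVec_diagonal, Finset.mul_sum, ← Finset.sum_sub_distrib]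
  exact Finset.sum_congr rfl fun i _ => by ring

/-- A symmetric matrix has a plane on which `A - c` is negative definite exactly when at least two
of its eigenvalues, with multiplicity, are less than `c`. -/
lemma hasNegPlane_iff_two_le_card (hA : A.IsHermitian) (c : ℝ) :
    HasNegPlane c A ↔ 2 ≤ (A.charpoly.roots.filter (· < c)).card := by
  have hcard : (A.charpoly.roots.filter (· < c)).card =
      (Finset.univ.filter fun i => hA.eigenvalues i < c).card := by
    rw [hA.roots_charpoly_eq_eigenvalues, Multiset.filter_map, Multiset.card_map]
    rfl
  rw [hcard]
  constructor
  · intro h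
    by_contra! hlt
    have hle := Nat.le_of_lt_succ hlt
    have hsurj : ∀ x : V → ℝ, ∃ z, x = (hA.eigenvectorUnitary : Matrix V V ℝ) *ᵥ z ∧
        z = (hA.eigenvectorUnitary : Matrix V V ℝ)ᵀ *ᵥ x := fun x =>
      ⟨_, by
        have := Unitary.coe_mul_star_self hA.eigenvectorUnitary
        rw [Unitary.coe_star, star_eq_conjTranspose, conjTranspose_eq_transpose_of_trivial] at this
        rw [mulVec_mulVec, this, one_mulVec], rfl⟩
    rcases isEmpty_or_nonempty V with hV | hV
    · exact not_hasNegPlane_of_nonneg_on_ker 0 (fun x _ => by simp [shiftedForm_eq_sum]) h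
    obtain ⟨k, hk⟩ : ∃ k, ∀ i, hA.eigenvalues i < c → i = k := by
      by_cases hne : ∃ k, hA.eigenvalues k < c
      · obtain ⟨k, hk⟩ := hne
        exact ⟨k, fun i hi => Finset.card_le_one.1 hle i (by simp [hi]) k (by simp [hk])⟩
      · exact ⟨hV.some, fun i hi => (hne ⟨i, hi⟩).elim⟩
    refine not_hasNegPlane_of_nonneg_on_ker
      (LinearMap.proj k ∘ₗ (hA.eigenvectorUnitary : Matrix V V ℝ)ᵀ.mulVecLin)
      (fun x hx => ?_) h
    obtain ⟨z, hxz, hz⟩ := hsurj x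
    have hzk : z k = 0 := by rw [hz]; exact hx
    rw [hxz, shiftedForm_eigenvectorUnitary_mulVec]
    refine Finset.sum_nonneg fun i _ => ?_
    by_cases hi : hA.eigenvalues i < c
    · simp [hk i hi, hzk]
    · exact mul_nonneg (by linarith) (sq_nonneg _)
  · intro h
    obtain ⟨i, hi, j, hj, hij⟩ := Finset.one_lt_card.1 h
    simp only [Finset.mem_filter, Finset.mem_univ, true_and] at hi hj
    refine ⟨(hA.eigenvectorUnitary : Matrix V V ℝ) *ᵥ Pi.single i 1,
      (hA.eigenvectorUnitary : Matrix V V ℝ) *ᵥ Pi.single j 1, fun a b hab => ?_⟩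
    rw [← mulVec_smul, ← mulVec_smul, ← mulVec_add, shiftedForm_eigenvectorUnitary_mulVec]
    have hterm : ∀ k, (hA.eigenvalues k - c) *
        (a • (Pi.single i 1 : V → ℝ) + b • (Pi.single j 1 : V → ℝ)) k ^ 2 =
        (if k = i then (hA.eigenvalues i - c) * a ^ 2 else 0) +
          (if k = j then (hA.eigenvalues j - c) * b ^ 2 else 0) := fun k => by
      by_cases h1 : k = i
      · subst h1
        simp [hij]
      · by_cases h2 : k = j
        · subst h2
          simp [h1]
        · simp [h1, h2]
    rw [Finset.sum_congr rfl fun k _ => hterm k, Finset.sum_add_distrib]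
    simp only [Finset.sum_ite_eq', Finset.mem_univ, if_true]
    rcases hab with ha | hb
    · nlinarith [sq_nonneg b, mul_pos (sub_pos.2 hi) (pow_pos (abs_pos.2 ha) 2),
        mul_nonneg (sub_pos.2 hj).le (sq_nonneg b), sq_abs a]
    · nlinarith [sq_nonneg a, mul_pos (sub_pos.2 hj) (pow_pos (abs_pos.2 hb) 2),
        mul_nonneg (sub_pos.2 hi).le (sq_nonneg a), sq_abs b]

end Spectral

lemma adjMat_apply {V : Type*} [Fintype V] (G : SimpleGraph V) [DecidableRel G.Adj] (u v : V) :
    adjMat ℝ G u v = if G.Adj u v then 1 else 0 := by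
  simp [adjMat, SimpleGraph.adjMatrix_apply]

lemma isHermitian_adjMat {V : Type*} [Fintype V] (G : SimpleGraph V) :
    (adjMat ℝ G).IsHermitian := by
  classical
  ext u v
  simp [adjMat_apply, G.adj_comm]

lemma HasNegPlane.of_embedding {V W : Type*} [Fintype V] [Fintype W] {c : ℝ}
    {G : SimpleGraph V} {H : SimpleGraph W} (f : H ↪g G) (h : HasNegPlane c (adjMat ℝ H)) :
    HasNegPlane c (adjMat ℝ G) := by
  classical
  refine HasNegPlane.of_submatrix f.injective ?_
  convert h using 1
  ext u v
  simp [adjMat_apply]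

lemma Cospectral.hasNegPlane_iff {V W : Type*} [Fintype V] [Fintype W] [DecidableEq V]
    [DecidableEq W] {G : SimpleGraph V} {H : SimpleGraph W} (h : Cospectral G H) (c : ℝ) :
    HasNegPlane c (adjMat ℝ G) ↔ HasNegPlane c (adjMat ℝ H) := by
  rw [hasNegPlane_iff_two_le_card (isHermitian_adjMat G),
    hasNegPlane_iff_two_le_card (isHermitian_adjMat H), h]

lemma friendshipGraph_adj_some {n : ℕ} (p q : Fin n × Bool) :
    (friendshipGraph n).Adj (some p) (some q) ↔ p.1 = q.1 ∧ p.2 ≠ q.2 := by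
  obtain ⟨i, b⟩ := p
  obtain ⟨j, b'⟩ := q
  cases b <;> cases b' <;> simp [friendshipGraph, eq_comm]

lemma not_hasNegPlane_friendshipGraph (n : ℕ) :
    ¬ HasNegPlane (-1) (adjMat ℝ (friendshipGraph n)) := by
  classical
  refine not_hasNegPlane_of_nonneg_on_ker (LinearMap.proj none) fun x hx => ?_
  replace hx : x none = 0 := hx
  have : shiftedForm (-1) (adjMat ℝ (friendshipGraph n)) x =
      ∑ i, (x (some (i, true)) + x (some (i, false))) ^ 2 := by
    simp only [shiftedForm_eq_sum, Fintype.sum_option, hx, Fintype.sum_prod_type,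
      Fintype.sum_bool, adjMat_apply, friendshipGraph_adj_some]
    simp
    exact Finset.sum_congr rfl fun i _ => by ring
  rw [this]
  positivity

lemma hasNegPlane_of_shiftedForm_eq {V : Type*} [Fintype V] {c : ℝ} {A : Matrix V V ℝ}
    (x y : V → ℝ) {p q : ℝ} (hp : 0 < p) (hq : 0 < q)
    (h : ∀ a b : ℝ, shiftedForm c A (a • x + b • y) = -(p * a ^ 2 + q * b ^ 2)) :
    HasNegPlane c A := by
  refine ⟨x, y, fun a b hab => ?_⟩
  rw [h, neg_lt_zero]
  rcases hab with ha | hb <;> positivity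

lemma hasNegPlane_cycleGraph_five :
    HasNegPlane (-1) (adjMat ℝ (SimpleGraph.cycleGraph 5)) := by
  refine hasNegPlane_of_shiftedForm_eq ![3, -2, 1, 1, -2] ![0, -1, 1, -1, 1]
    (p := 11) (q := 2) (by norm_num) (by norm_num) fun a b => ?_
  simp +decide [shiftedForm_eq_sum, Fin.sum_univ_five, adjMat_apply]
  ring

lemma hasNegPlane_compl_cycleGraph_five :
    HasNegPlane (-1) (adjMat ℝ (SimpleGraph.cycleGraph 5)ᶜ) := by
  refine hasNegPlane_of_shiftedForm_eq ![3, 1, -2, -2, 1] ![0, -1, -1, 1, 1]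
    (p := 11) (q := 2) (by norm_num) (by norm_num) fun a b => ?_
  simp +decide [shiftedForm_eq_sum, Fin.sum_univ_five, adjMat_apply]
  ring

lemma hasNegPlane_pathGraph_six :
    HasNegPlane (-1) (adjMat ℝ (SimpleGraph.pathGraph 6)) := by
  classical
  refine hasNegPlane_of_shiftedForm_eq ![2, -2, 1, 1, -2, 2] ![1, -1, 1, -1, 1, -1]
    (p := 4) (q := 4) (by norm_num) (by norm_num) fun a b => ?_
  simp +decide [shiftedForm_eq_sum, Fin.sum_univ_six, adjMat_apply, SimpleGraph.pathGraph_adj]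
  ring

lemma hasNegPlane_compl_pathGraph_six :
    HasNegPlane (-1) (adjMat ℝ (SimpleGraph.pathGraph 6)ᶜ) := by
  classical
  refine hasNegPlane_of_shiftedForm_eq ![-1, 0, 1, 1, 0, -1] ![1, 1, 0, 0, -1, -1]
    (p := 2) (q := 4) (by norm_num) (by norm_num) fun a b => ?_
  simp +decide [shiftedForm_eq_sum, Fin.sum_univ_six, adjMat_apply, SimpleGraph.pathGraph_adj]
  ring

/-- A path on `k` vertices is an induced subgraph of every cycle with more than `k` vertices. -/
def pathGraphEmbeddingCycleGraph {k m : ℕ} (h : k < m) :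
    SimpleGraph.pathGraph k ↪g SimpleGraph.cycleGraph m where
  toFun := Fin.castLE h.le
  inj' := Fin.castLE_injective h.le
  map_rel_iff' := by
    intro i j
    simp only [Function.Embedding.coeFn_mk, SimpleGraph.cycleGraph_adj',
      SimpleGraph.pathGraph_adj, Fin.sub_def, Fin.val_castLE]
    have hi := i.isLt
    have hj := j.isLt
    rcases lt_trichotomy i.val j.val with hij | hij | hij
    · rw [Nat.mod_eq_of_lt (by omega : m - j.val + i.val < m),
        show m - i.val + j.val = m + (j.val - i.val) by omega, Nat.add_mod_left,
        Nat.mod_eq_of_lt (by omega)]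
      omega
    · rw [hij, Nat.sub_add_cancel (by omega), Nat.mod_self]
      omega
    · rw [Nat.mod_eq_of_lt (by omega : m - i.val + j.val < m),
        show m - j.val + i.val = m + (i.val - j.val) by omega, Nat.add_mod_left,
        Nat.mod_eq_of_lt (by omega)]
      omega

lemma hasNegPlane_cycleGraph {m : ℕ} (hodd : Odd m) (hm : 5 ≤ m) :
    HasNegPlane (-1) (adjMat ℝ (SimpleGraph.cycleGraph m)) ∧
      HasNegPlane (-1) (adjMat ℝ (SimpleGraph.cycleGraph m)ᶜ) := by
  rcases hm.eq_or_lt with rfl | hlt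
  · exact ⟨hasNegPlane_cycleGraph_five, hasNegPlane_compl_cycleGraph_five⟩
  · have h6 : 6 < m := by
      obtain ⟨k, rfl⟩ := hodd
      omega
    exact ⟨hasNegPlane_pathGraph_six.of_embedding (pathGraphEmbeddingCycleGraph h6),
      hasNegPlane_compl_pathGraph_six.of_embedding
        (SimpleGraph.Embedding.complEquiv (pathGraphEmbeddingCycleGraph h6))⟩

/-- if `G` is cospectral with the friendship graph `F n`, then `G` has no
induced odd cycle `C_m` with `m ≥ 5` and no induced complement of such a cycle
(so `G` and its complement are Berge, hence perfect). -/
theorem cospectral_no_odd_hole_no_odd_antihole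
    {V : Type*} [Fintype V] [DecidableEq V]
    (n : ℕ) (hn : 0 < n) (G : SimpleGraph V)
    (hG : Cospectral G (friendshipGraph n)) :
    ∀ m : ℕ, Odd m → 5 ≤ m →
      IsEmpty (SimpleGraph.cycleGraph m ↪g G) ∧
      IsEmpty ((SimpleGraph.cycleGraph m)ᶜ ↪g G) := by
  intro m hodd hm
  have hneg : ¬ HasNegPlane (-1) (adjMat ℝ G) := fun h =>
    not_hasNegPlane_friendshipGraph n ((hG.hasNegPlane_iff _).1 h)
  obtain ⟨hcycle, hcompl⟩ := hasNegPlane_cycleGraph hodd hm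
  exact ⟨⟨fun f => hneg (hcycle.of_embedding f)⟩, ⟨fun f => hneg (hcompl.of_embedding f)⟩⟩
end

section
/- Let n be a positive integer and let G be a graph cospectral with the friendship graph F_n. If x and y are two non-adjacent vertices of G, each of degree 2, then x and y cannot have two distinct common neighbours; equivalently, the neighbourhoods of x and y in G are not equal. -/
open Polynomial

lemma adjMat_apply_of_adj {V : Type*} [Fintype V] {G : SimpleGraph V} {u v : V}
    (h : G.Adj u v) : adjMat ℝ G u v = 1 := by
  simp [adjMat, SimpleGraph.adjMatrix_apply, h]

lemma adjMat_apply_of_not_adj {V : Type*} [Fintype V] {G : SimpleGraph V} {u v : V}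
    (h : ¬ G.Adj u v) : adjMat ℝ G u v = 0 := by
  simp [adjMat, SimpleGraph.adjMatrix_apply, h]

lemma friendshipGraph_adj_none_some {n : ℕ} (p : Fin n × Bool) :
    (friendshipGraph n).Adj none (some p) := by
  simp [friendshipGraph]

lemma friendshipGraph_adj_some_some {n : ℕ} {i j : Fin n} {b c : Bool} :
    (friendshipGraph n).Adj (some (i, b)) (some (j, c)) ↔ j = i ∧ c = !b := by
  cases b <;> cases c <;> simp [friendshipGraph, eq_comm]

/-- `0` is not an adjacency eigenvalue of a nontrivial friendship graph. -/
lemma det_adjMat_friendshipGraph_ne_zero {n : ℕ} (hn : 0 < n) :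
    (adjMat ℝ (friendshipGraph n)).det ≠ 0 := by
  intro hdet
  obtain ⟨v, hv, hAv⟩ := Matrix.exists_mulVec_eq_zero_iff.mpr hdet
  have hsome (i : Fin n) (b : Bool) : v none + v (some (i, !b)) = 0 := by
    have h := congrFun hAv (some (i, b))
    rw [Matrix.mulVec, dotProduct, Fintype.sum_option,
      Fintype.sum_eq_single (i, !b)] at h
    · rwa [adjMat_apply_of_adj (friendshipGraph_adj_none_some _).symm,
        adjMat_apply_of_adj (friendshipGraph_adj_some_some.mpr ⟨rfl, rfl⟩),
        one_mul, one_mul] at h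
    · rintro ⟨j, c⟩ hjc
      rw [adjMat_apply_of_not_adj, zero_mul]
      rw [friendshipGraph_adj_some_some]
      rintro ⟨rfl, rfl⟩
      exact hjc rfl
  have hv_some (p : Fin n × Bool) : v (some p) = -v none := by
    have h := hsome p.1 (!p.2)
    rw [Bool.not_not] at h
    exact eq_neg_of_add_eq_zero_right h
  have hnone : v none = 0 := by
    have h := congrFun hAv none
    simp only [Matrix.mulVec, dotProduct, Fintype.sum_option,
      adjMat_apply_of_not_adj (friendshipGraph n).irrefl,
      adjMat_apply_of_adj (friendshipGraph_adj_none_some _), hv_some] at h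
    simpa [hn.ne'] using h
  refine hv (funext fun u => ?_)
  cases u with
  | none => exact hnone
  | some p => simp [hv_some, hnone]

/-- Two distinct vertices with the same neighbours force `0` to be an adjacency eigenvalue. -/
lemma det_adjMat_eq_zero_of_neighborSet_eq {V : Type*} [Fintype V] [DecidableEq V]
    {G : SimpleGraph V} {x y : V} (hne : x ≠ y) (h : G.neighborSet x = G.neighborSet y) :
    (adjMat ℝ G).det = 0 := by
  refine Matrix.det_zero_of_row_eq hne (funext fun z => ?_)
  have hz : G.Adj x z ↔ G.Adj y z := Set.ext_iff.mp h z
  by_cases hxz : G.Adj x z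
  · rw [adjMat_apply_of_adj hxz, adjMat_apply_of_adj (hz.mp hxz)]
  · rw [adjMat_apply_of_not_adj hxz, adjMat_apply_of_not_adj (mt hz.mpr hxz)]

lemma Cospectral.det_eq_zero_iff {V W : Type*} [Fintype V] [Fintype W] [DecidableEq V]
    [DecidableEq W] {G : SimpleGraph V} {H : SimpleGraph W} (h : Cospectral G H) :
    (adjMat ℝ G).det = 0 ↔ (adjMat ℝ H).det = 0 := by
  rw [Matrix.det_eq_sign_charpoly_coeff, Matrix.det_eq_sign_charpoly_coeff (adjMat ℝ H),
    show (adjMat ℝ G).charpoly = (adjMat ℝ H).charpoly from h]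
  simp

lemma neighborFinset_eq_pair_of_degree_eq_two {V : Type*} [Fintype V] [DecidableEq V]
    {G : SimpleGraph V} [DecidableRel G.Adj] {x a b : V} (hd : G.degree x = 2) (hab : a ≠ b)
    (ha : G.Adj x a) (hb : G.Adj x b) : G.neighborFinset x = {a, b} := by
  refine (Finset.eq_of_subset_of_card_le ?_ ?_).symm
  · simp [Finset.insert_subset_iff, ha, hb]
  · rw [G.card_neighborFinset_eq_degree, hd, Finset.card_pair hab]

/-- if `G` is cospectral with the friendship graph `F n` and `x, y` are two
non-adjacent vertices of degree 2, then `x` and `y` do not have two distinct common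
neighbours; equivalently, their neighbourhoods are not equal. -/
theorem nonadjacent_degree_two_no_two_common_neighbours
    {V : Type*} [Fintype V] [DecidableEq V]
    (n : ℕ) (hn : 0 < n) (G : SimpleGraph V) [DecidableRel G.Adj]
    (hG : Cospectral G (friendshipGraph n))
    (x y : V) (hne : x ≠ y) (hnadj : ¬ G.Adj x y)
    (hdx : G.degree x = 2) (hdy : G.degree y = 2) :
    (¬ ∃ a b : V, a ≠ b ∧ G.Adj x a ∧ G.Adj y a ∧ G.Adj x b ∧ G.Adj y b) ∧
      G.neighborSet x ≠ G.neighborSet y := by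
  have hnbr : G.neighborSet x ≠ G.neighborSet y := fun h =>
    det_adjMat_friendshipGraph_ne_zero hn
      (hG.det_eq_zero_iff.mp (det_adjMat_eq_zero_of_neighborSet_eq hne h))
  refine ⟨?_, hnbr⟩
  rintro ⟨a, b, hab, hxa, hya, hxb, hyb⟩
  apply hnbr
  rw [← G.coe_neighborFinset x, ← G.coe_neighborFinset y,
    neighborFinset_eq_pair_of_degree_eq_two hdx hab hxa hxb,
    neighborFinset_eq_pair_of_degree_eq_two hdy hab hya hyb]
end
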